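/- arXiv:2407.07165 — 2 statements merged into one kernel-verified Lean document; each statement's English description precedes it below -/
import Mathlib

section
/- Let G be a group acting on a type X, N a positive natural number, and r : Fin N → Set X a family of N subsets that is permuted by the action: there exists π : G → Equiv.Perm (Fin N) such that for every g ∈ G and i : Fin N, the image g • (r i) equals r (π g i). Then every level set r̃_a (1 ≤ a ≤ N) is invariant under the action: g • r̃_a = r̃_a for all g ∈ G. -/
open Pointwise

/-- The `a`-th level set of a family of sets: points belonging to at least `a` of the sets. -/
def levelSet {X : Type*} (N : ℕ) (r : Fin N → Set X) (a : ℕ) : Set X :=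
  {x | a ≤ Set.ncard {i : Fin N | x ∈ r i}}

theorem levelSet_smul_invariant {G X : Type*} [Group G] [MulAction G X]
    (N : ℕ) (hN : 0 < N) (r : Fin N → Set X) (π : G → Equiv.Perm (Fin N))
    (hperm : ∀ (g : G) (i : Fin N), g • r i = r (π g i)) :
    ∀ (g : G) (a : ℕ), 1 ≤ a → a ≤ N → g • levelSet N r a = levelSet N r a := by
  intro g a _ _
  ext x
  have h : {i : Fin N | g⁻¹ • x ∈ r i} = π g ⁻¹' {i : Fin N | x ∈ r i} := by
    ext i
    simp [← hperm, Set.mem_smul_set_iff_inv_smul_mem]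
  rw [Set.mem_smul_set_iff_inv_smul_mem, levelSet, Set.mem_ofPred_eq, Set.mem_ofPred_eq, h,
    Set.ncard_preimage_of_injective_subset_range (π g).injective (by simp)]
end

section
/- Let ℓ₁, ℓ₂, α be real numbers and define A := !![e^{ℓ₁}, 0; 0, e^{−ℓ₁}] and B := cosh ℓ₂ · 1 + sinh ℓ₂ · !![cos α, sin α; sin α, −cos α] (both have determinant 1). Then the trace of the commutator satisfies Tr(A·B·A⁻¹·B⁻¹) = 2·(cosh² ℓ₂ + (cos 2α · sinh² ℓ₁ − cosh² ℓ₁) · sinh² ℓ₂). -/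
open Matrix Real

/-- The inverse of a `2 × 2` matrix of determinant one is its adjugate. -/
theorem inv_of_det_eq_one {R : Type*} [CommRing R] (a b c d : R) (h : a * d - b * c = 1) :
    !![a, b; c, d]⁻¹ = !![d, -b; -c, a] := by
  rw [Matrix.inv_def, Matrix.det_fin_two_of, h, Matrix.adjugate_fin_two_of]
  simp

theorem trace_commutator_torus (ℓ₁ ℓ₂ α : ℝ) :
    Matrix.trace
        ((!![Real.exp ℓ₁, 0; 0, Real.exp (-ℓ₁)] : Matrix (Fin 2) (Fin 2) ℝ)
          * (Real.cosh ℓ₂ • (1 : Matrix (Fin 2) (Fin 2) ℝ)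
              + Real.sinh ℓ₂ • !![Real.cos α, Real.sin α; Real.sin α, -Real.cos α])
          * (!![Real.exp ℓ₁, 0; 0, Real.exp (-ℓ₁)] : Matrix (Fin 2) (Fin 2) ℝ)⁻¹
          * (Real.cosh ℓ₂ • (1 : Matrix (Fin 2) (Fin 2) ℝ)
              + Real.sinh ℓ₂ • !![Real.cos α, Real.sin α; Real.sin α, -Real.cos α])⁻¹)
      = 2 * (Real.cosh ℓ₂ ^ 2
          + (Real.cos (2 * α) * Real.sinh ℓ₁ ^ 2 - Real.cosh ℓ₁ ^ 2) * Real.sinh ℓ₂ ^ 2) := by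
  have hA := inv_of_det_eq_one (Real.exp ℓ₁) 0 0 (Real.exp (-ℓ₁))
    (by rw [← Real.exp_add]; simp)
  have hB : Real.cosh ℓ₂ • (1 : Matrix (Fin 2) (Fin 2) ℝ)
      + Real.sinh ℓ₂ • !![Real.cos α, Real.sin α; Real.sin α, -Real.cos α]
      = !![Real.cosh ℓ₂ + Real.sinh ℓ₂ * Real.cos α, Real.sinh ℓ₂ * Real.sin α;
        Real.sinh ℓ₂ * Real.sin α, Real.cosh ℓ₂ - Real.sinh ℓ₂ * Real.cos α] := by
    ext i j
    fin_cases i <;> fin_cases j <;> simp [sub_eq_add_neg]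
  have hc := Real.sin_sq_add_cos_sq α
  have h₁ := Real.cosh_sq ℓ₁
  have h₂ := Real.cosh_sq ℓ₂
  rw [hB, hA, inv_of_det_eq_one _ _ _ _
    (by linear_combination h₂ - Real.sinh ℓ₂ ^ 2 * hc)]
  simp only [Matrix.mul_fin_two, Matrix.trace_fin_two_of]
  rw [← Real.cosh_add_sinh, ← Real.cosh_sub_sinh, Real.cos_two_mul]
  grind
end
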